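/- For every antisymmetric CM-DMBC, the uniform input distribution U on 𝒳 maximizes P ↦ min_{k∈{1,2}} I_k(P): for every input distribution P, min_k I_k(P) ≤ min_k I_k(U), and moreover min_k I_k(U) = (1/2)·( Σ_{j=1}^r (p_{1j}+p_{2j})·log( 2|Ȳ_j| / (p_{1j}+p_{2j}) ) − H(r₁) − H(r₂) ), where r_k denotes the first row of W_k and H(·) is the Shannon entropy of a probability vector. -/

import Mathlib

open Finset

noncomputable section

variable {𝒳 𝒴 : Type*} [Fintype 𝒳] [Fintype 𝒴]

/-- `P` is a probability distribution on the finite alphabet `𝒳`. -/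
def IsDist (P : 𝒳 → ℝ) : Prop := (∀ x, 0 ≤ P x) ∧ ∑ x, P x = 1

/-- The output distribution `PW` induced by input distribution `P` and channel `W`. -/
def outDist (P : 𝒳 → ℝ) (W : 𝒳 → 𝒴 → ℝ) (y : 𝒴) : ℝ := ∑ x, P x * W x y

/-- The mutual information `I(P, W)` (natural logarithm). -/
def mutInfo (P : 𝒳 → ℝ) (W : 𝒳 → 𝒴 → ℝ) : ℝ :=
  ∑ x, ∑ y, P x * W x y * Real.log (W x y / outDist P W y)

/-- Relative entropy (KL divergence) between two pmfs on a finite alphabet. -/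
def relEnt (p q : 𝒴 → ℝ) : ℝ := ∑ y, p y * Real.log (p y / q y)

/-- Directional derivative `∇I_k(v)` of the mutual information at `P*` along `v`. -/
def gradI (Pstar : 𝒳 → ℝ) (W : 𝒳 → 𝒴 → ℝ) (v : 𝒳 → ℝ) : ℝ :=
  ∑ x, v x * relEnt (W x) (outDist Pstar W)


/-- A weakly symmetric stochastic matrix with `N` rows, supported on the output
set `S`: nonnegative entries, rows supported on `S` summing to one, each row a
permutation (within `S`) of any other row, and all column sums over `S` equal. -/
def WeaklySymmetricOn (S : Finset 𝒴) (N : ℕ) (Mtx : Fin N → 𝒴 → ℝ) : Prop :=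
  (∀ u y, 0 ≤ Mtx u y) ∧
  (∀ u y, y ∉ S → Mtx u y = 0) ∧
  (∀ u, ∑ y ∈ S, Mtx u y = 1) ∧
  (∀ u u', ∃ σ : 𝒴 ≃ 𝒴, (∀ y ∈ S, σ y ∈ S) ∧ ∀ y ∈ S, Mtx u' (σ y) = Mtx u y) ∧
  (∀ y ∈ S, ∀ y' ∈ S, ∑ u, Mtx u y = ∑ u, Mtx u y')

/-- The uniform input distribution on `𝒳 = Fin 2 × Fin N` (an alphabet of size `2N`). -/
def unifDist (N : ℕ) : Fin 2 × Fin N → ℝ := fun _ => 1 / (2 * N)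

/-- Shannon entropy of a probability vector (natural logarithm). -/
def entH (q : 𝒴 → ℝ) : ℝ := -∑ y, q y * Real.log (q y)

/-- The row of a block channel: on the output block `j`, a weight `p j` times the row `u` of the
matrix `M j`. -/
def blockRow {N r : ℕ} (part : 𝒴 → Fin r) (p : Fin r → ℝ) (M : Fin r → Fin N → 𝒴 → ℝ)
    (u : Fin N) (y : 𝒴) : ℝ :=
  p (part y) * M (part y) u y

theorem mutInfo_eq_sum_relEnt (P : 𝒳 → ℝ) (W : 𝒳 → 𝒴 → ℝ) :
    mutInfo P W = ∑ x, P x * relEnt (W x) (outDist P W) := by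
  simp only [mutInfo, relEnt, Finset.mul_sum, mul_assoc]

theorem sum_outDist {P : 𝒳 → ℝ} {W : 𝒳 → 𝒴 → ℝ} (hP : ∑ x, P x = 1)
    (hW : ∀ x, ∑ y, W x y = 1) : ∑ y, outDist P W y = 1 := by
  simp only [outDist]
  rw [Finset.sum_comm]
  simp [← Finset.mul_sum, hW, hP]

/-- The mutual information is at most the average relative entropy of the channel rows to any
fixed output distribution. -/
theorem mutInfo_le_sum_relEnt {P : 𝒳 → ℝ} {W : 𝒳 → 𝒴 → ℝ} {q : 𝒴 → ℝ} (hP : IsDist P)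
    (hW : ∀ x y, 0 ≤ W x y) (hW1 : ∀ x, ∑ y, W x y = 1) (hq : IsDist q)
    (hqW : ∀ y, q y = 0 → ∀ x, W x y = 0) :
    mutInfo P W ≤ ∑ x, P x * relEnt (W x) q := by
  have key : ∀ y, ∑ x, P x * W x y * Real.log (W x y / outDist P W y) ≤
      ∑ x, P x * W x y * Real.log (W x y / q y) + (q y - outDist P W y) := by
    intro y
    have hnn : ∀ x, 0 ≤ P x * W x y := fun x => mul_nonneg (hP.1 x) (hW x y)
    have hle : ∀ x, P x * W x y ≤ outDist P W y := fun x =>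
      Finset.single_le_sum (f := fun x => P x * W x y) (fun x _ => hnn x) (Finset.mem_univ x)
    have hout : 0 ≤ outDist P W y := Finset.sum_nonneg fun x _ => hnn x
    rcases hout.eq_or_lt with h0 | hpos
    · have hz : ∀ x, P x * W x y = 0 := fun x => le_antisymm (h0 ▸ hle x) (hnn x)
      simp [hz, ← h0, hq.1 y]
    · have hsum : q y - outDist P W y = ∑ x, P x * W x y * (q y / outDist P W y - 1) := by
        rw [← Finset.sum_mul]
        change _ = outDist P W y * _
        field_simp
      rw [hsum, ← Finset.sum_add_distrib]
      refine Finset.sum_le_sum fun x _ => ?_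
      rcases (hW x y).eq_or_lt with hw | hw
      · simp [← hw]
      have hqpos : 0 < q y := (hq.1 y).lt_of_ne fun h => hw.ne' (hqW y h.symm x)
      rw [← mul_add]
      refine mul_le_mul_of_nonneg_left ?_ (hnn x)
      have hlog := Real.log_le_sub_one_of_pos (div_pos hqpos hpos)
      rw [Real.log_div hqpos.ne' hpos.ne'] at hlog
      rw [Real.log_div hw.ne' hpos.ne', Real.log_div hw.ne' hqpos.ne']
      linarith
  have hsum := Finset.sum_le_sum fun y (_ : y ∈ Finset.univ) => key y
  rw [Finset.sum_add_distrib, Finset.sum_sub_distrib, hq.2, sum_outDist hP.2 hW1, sub_self,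
    add_zero] at hsum
  rw [Finset.sum_comm] at hsum
  refine hsum.trans_eq ?_
  rw [Finset.sum_comm]
  simp only [relEnt, Finset.mul_sum, mul_assoc]

namespace WeaklySymmetricOn

variable {α : Type*} {S : Finset α} {N : ℕ} {M : Fin N → α → ℝ}

theorem sum_col_mul_card (h : WeaklySymmetricOn S N M) {y : α} (hy : y ∈ S) :
    (∑ u, M u y) * (S.card : ℝ) = N := by
  have h1 : ∑ y' ∈ S, ∑ u, M u y' = ∑ y' ∈ S, ∑ u, M u y :=
    Finset.sum_congr rfl fun y' hy' => h.2.2.2.2 y' hy' y hy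
  rw [Finset.sum_comm] at h1
  simp only [h.2.2.1, Finset.sum_const, nsmul_eq_mul, Finset.card_univ, Fintype.card_fin] at h1
  linarith

theorem sum_comp_row_eq (h : WeaklySymmetricOn S N M) (F : ℝ → ℝ) (u u' : Fin N) :
    ∑ y ∈ S, F (M u y) = ∑ y ∈ S, F (M u' y) := by
  obtain ⟨σ, hσ, hM⟩ := h.2.2.2.1 u u'
  have himg : S.map σ.toEmbedding = S :=
    Finset.eq_of_subset_of_card_le
      (fun z hz => by
        obtain ⟨y, hy, rfl⟩ := Finset.mem_map.1 hz
        exact hσ y hy)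
      (Finset.card_map _).ge
  conv_rhs => rw [← himg, Finset.sum_map]
  exact Finset.sum_congr rfl fun y hy => congrArg F (hM y hy).symm

end WeaklySymmetricOn

section BlockRow

variable {N r : ℕ} {part : 𝒴 → Fin r} {M : Fin r → Fin N → 𝒴 → ℝ}

theorem sum_mul_blockRow
    (hM : ∀ j, WeaklySymmetricOn (Finset.univ.filter fun y => part y = j) N (M j))
    (p c : Fin r → ℝ) (u : Fin N) :
    ∑ y, blockRow part p M u y * c (part y) = ∑ j, p j * c j := by
  rw [← Finset.sum_fiberwise _ part]
  refine Finset.sum_congr rfl fun j _ => ?_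
  have h : ∀ y ∈ Finset.univ.filter (fun y => part y = j),
      blockRow part p M u y * c (part y) = p j * c j * M j u y := by
    intro y hy
    obtain rfl := (Finset.mem_filter.1 hy).2
    simp only [blockRow]
    ring
  rw [Finset.sum_congr rfl h, ← Finset.mul_sum, (hM j).2.2.1, mul_one]

theorem sum_comp_blockRow_eq
    (hM : ∀ j, WeaklySymmetricOn (Finset.univ.filter fun y => part y = j) N (M j))
    (p : Fin r → ℝ) (F : Fin r → ℝ → ℝ) (u u' : Fin N) :
    ∑ y, F (part y) (blockRow part p M u y) = ∑ y, F (part y) (blockRow part p M u' y) := by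
  rw [← Finset.sum_fiberwise _ part, ← Finset.sum_fiberwise _ part]
  refine Finset.sum_congr rfl fun j _ => ?_
  have h : ∀ v, ∑ y ∈ Finset.univ.filter (fun y => part y = j),
      F (part y) (blockRow part p M v y) =
      ∑ y ∈ Finset.univ.filter (fun y => part y = j), F j (p j * M j v y) := by
    intro v
    refine Finset.sum_congr rfl fun y hy => ?_
    obtain rfl := (Finset.mem_filter.1 hy).2
    rfl
  rw [h, h]
  exact (hM j).sum_comp_row_eq (fun t => F j (p j * t)) u u'

theorem relEnt_blockRow
    (hM : ∀ j, WeaklySymmetricOn (Finset.univ.filter fun y => part y = j) N (M j))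
    (p c : Fin r → ℝ) (hc : ∀ j, c j = 0 → p j = 0) (u : Fin N) :
    relEnt (blockRow part p M u) (fun y => c (part y)) =
      ∑ j, p j * Real.log (c j)⁻¹ - entH (blockRow part p M u) := by
  rw [← sum_mul_blockRow hM p (fun j => Real.log (c j)⁻¹) u, entH, sub_neg_eq_add,
    ← Finset.sum_add_distrib, relEnt]
  refine Finset.sum_congr rfl fun y _ => ?_
  by_cases hb : blockRow part p M u y = 0
  · simp [hb]
  have hcy : c (part y) ≠ 0 := fun h => hb (by simp [blockRow, hc _ h])
  rw [Real.log_div hb hcy, Real.log_inv]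
  ring

end BlockRow

/-- The output distribution induced by the uniform input on a channel with two groups of `N`
weakly symmetric block rows is constant on each output block. -/
theorem outDist_unifDist_block {N r : ℕ} (hN : 0 < N) {part : 𝒴 → Fin r} {p : Fin 2 → Fin r → ℝ}
    {M : Fin 2 → Fin r → Fin N → 𝒴 → ℝ}
    (hM : ∀ k j, WeaklySymmetricOn (Finset.univ.filter fun y => part y = j) N (M k j)) (y : 𝒴) :
    outDist (unifDist N) (fun x => blockRow part (p x.1) (M x.1) x.2) y =
      (p 0 (part y) + p 1 (part y)) /
        (2 * ((Finset.univ.filter fun y' => part y' = part y).card : ℝ)) := by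
  have hy : y ∈ Finset.univ.filter fun y' => part y' = part y := by simp
  have hcard : ((Finset.univ.filter fun y' => part y' = part y).card : ℝ) ≠ 0 := by
    exact_mod_cast (Finset.card_pos.2 ⟨y, hy⟩).ne'
  have hN' : (N : ℝ) ≠ 0 := by exact_mod_cast hN.ne'
  have h : ∀ k, ∑ u, M k (part y) u y =
      N / ((Finset.univ.filter fun y' => part y' = part y).card : ℝ) := fun k =>
    (eq_div_iff hcard).2 ((hM k (part y)).sum_col_mul_card hy)
  simp only [outDist, unifDist, blockRow]
  rw [← Finset.mul_sum, Fintype.sum_prod_type, Fin.sum_univ_two]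
  simp only [← Finset.mul_sum, h]
  field_simp

theorem isDist_unifDist {N : ℕ} (hN : 0 < N) : IsDist (unifDist N) := by
  have hN' : (N : ℝ) ≠ 0 := by exact_mod_cast hN.ne'
  refine ⟨fun _ => by unfold unifDist; positivity, ?_⟩
  simp [unifDist]
  field_simp

theorem isDist_outDist {P : 𝒳 → ℝ} {W : 𝒳 → 𝒴 → ℝ} (hP : IsDist P) (hW : ∀ x y, 0 ≤ W x y)
    (hW1 : ∀ x, ∑ y, W x y = 1) : IsDist (outDist P W) :=
  ⟨fun y => Finset.sum_nonneg fun x _ => mul_nonneg (hP.1 x) (hW x y), sum_outDist hP.2 hW1⟩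

/-- For a channel with two groups of weakly symmetric block rows, the mutual information is at most
the average over the groups of the relative entropy to the output of the uniform distribution, with
equality for the uniform distribution. -/
theorem mutInfo_block_le {N r : ℕ} (hN : 0 < N) {part : 𝒴 → Fin r} {p : Fin 2 → Fin r → ℝ}
    {M : Fin 2 → Fin r → Fin N → 𝒴 → ℝ} (hp : ∀ k j, 0 ≤ p k j) (hpsum : ∀ k, ∑ j, p k j = 1)
    (hM : ∀ k j, WeaklySymmetricOn (Finset.univ.filter fun y => part y = j) N (M k j))
    {W : Fin 2 × Fin N → 𝒴 → ℝ} (hW : W = fun x => blockRow part (p x.1) (M x.1) x.2)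
    {D : Fin 2 → ℝ} (hD : D = fun k => ∑ j, p k j *
      Real.log (2 * ((Finset.univ.filter fun y => part y = j).card : ℝ) / (p 0 j + p 1 j))
        - entH (blockRow part (p k) (M k) ⟨0, hN⟩)) :
    (∀ P, IsDist P → mutInfo P W ≤ (∑ u, P (0, u)) * D 0 + (∑ u, P (1, u)) * D 1) ∧
      mutInfo (unifDist N) W = (D 0 + D 1) / 2 := by
  let c : Fin r → ℝ := fun j =>
    (p 0 j + p 1 j) / (2 * ((Finset.univ.filter fun y => part y = j).card : ℝ))
  have hcard : ∀ j, ((Finset.univ.filter fun y => part y = j).card : ℝ) ≠ 0 := by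
    intro j h
    have hrow := (hM 0 j).2.2.1 ⟨0, hN⟩
    rw [Finset.card_eq_zero.1 (Nat.cast_eq_zero.1 h)] at hrow
    simp at hrow
  have hc : ∀ k j, c j = 0 → p k j = 0 := by
    intro k j h
    have hs : p 0 j + p 1 j = 0 := by simpa [c, hcard j] using h
    have h0 := hp 0 j
    have h1 := hp 1 j
    fin_cases k
    · change p 0 j = 0
      linarith
    · change p 1 j = 0
      linarith
  have hout : outDist (unifDist N) W = fun y => c (part y) := by
    rw [hW]
    exact funext (outDist_unifDist_block hN hM)
  have hrel : ∀ x, relEnt (W x) (fun y => c (part y)) = D x.1 := by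
    intro x
    have h := sum_comp_blockRow_eq (hM x.1) (p x.1) (fun j t => t * Real.log (t / c j)) x.2 ⟨0, hN⟩
    have h' := relEnt_blockRow (hM x.1) (p x.1) c (hc x.1) ⟨0, hN⟩
    simp only [c, inv_div] at h'
    rw [hW, hD]
    exact h.trans h'
  have hWnn : ∀ x y, 0 ≤ W x y := by
    rw [hW]
    exact fun x y => mul_nonneg (hp _ _) ((hM _ _).1 _ _)
  have hW1 : ∀ x, ∑ y, W x y = 1 := by
    intro x
    have h := sum_mul_blockRow (hM x.1) (p x.1) (fun _ => 1) x.2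
    simpa [hW, hpsum] using h
  have hsum : ∀ P : Fin 2 × Fin N → ℝ, ∑ x, P x * relEnt (W x) (fun y => c (part y)) =
      (∑ u, P (0, u)) * D 0 + (∑ u, P (1, u)) * D 1 := by
    intro P
    simp only [hrel, Fintype.sum_prod_type, Fin.sum_univ_two, Finset.sum_mul]
  refine ⟨fun P hP => ?_, ?_⟩
  · rw [← hsum]
    refine mutInfo_le_sum_relEnt hP hWnn hW1 ?_ ?_
    · rw [← hout]
      exact isDist_outDist (isDist_unifDist hN) hWnn hW1
    · intro y hy x
      simp [hW, blockRow, hc x.1 _ hy]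
  · have hN' : (N : ℝ) ≠ 0 := by exact_mod_cast hN.ne'
    rw [mutInfo_eq_sum_relEnt, hout, hsum]
    simp only [unifDist, Finset.sum_const, Finset.card_univ, Fintype.card_fin, nsmul_eq_mul]
    field_simp

/-- For an antisymmetric CM-DMBC the uniform input distribution maximizes
`P ↦ min_k I_k(P)`, and the maximum equals
`½ (Σⱼ (p₁ⱼ+p₂ⱼ) log(2|Ȳⱼ|/(p₁ⱼ+p₂ⱼ)) − H(r₁) − H(r₂))`, where `r_k` is the
first row of `W_k`. -/
theorem antisymmetric_uniform_maximizes
    (N r : ℕ) (hN : 0 < N)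
    (W1 W2 : Fin 2 × Fin N → 𝒴 → ℝ)
    (part : 𝒴 → Fin r) (p : Fin 2 → Fin r → ℝ)
    (Wb : Fin 2 → Fin r → Fin N → 𝒴 → ℝ)
    (hp : ∀ k j, 0 ≤ p k j) (hpsum : ∀ k, ∑ j, p k j = 1)
    (hWb : ∀ k j, WeaklySymmetricOn (Finset.univ.filter fun y => part y = j) N (Wb k j))
    (hW1a : ∀ u y, W1 (0, u) y = p 0 (part y) * Wb 0 (part y) u y)
    (hW1b : ∀ u y, W1 (1, u) y = p 1 (part y) * Wb 1 (part y) u y)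
    (hW2a : ∀ u y, W2 (0, u) y = p 1 (part y) * Wb 1 (part y) u y)
    (hW2b : ∀ u y, W2 (1, u) y = p 0 (part y) * Wb 0 (part y) u y)
    :
    (∀ P : Fin 2 × Fin N → ℝ, IsDist P →
        min (mutInfo P W1) (mutInfo P W2)
          ≤ min (mutInfo (unifDist N) W1) (mutInfo (unifDist N) W2)) ∧
    min (mutInfo (unifDist N) W1) (mutInfo (unifDist N) W2)
      = (1 / 2) *
          ((∑ j, (p 0 j + p 1 j) *
              Real.log (2 * ((Finset.univ.filter fun y => part y = j).card : ℝ)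
                / (p 0 j + p 1 j)))
            - entH (fun y => W1 (0, ⟨0, hN⟩) y)
            - entH (fun y => W2 (0, ⟨0, hN⟩) y)) := by
  have hA := mutInfo_block_le hN hp hpsum hWb (W := W1)
    (funext fun x => funext fun y => by
      obtain ⟨k, u⟩ := x
      fin_cases k
      · exact hW1a u y
      · exact hW1b u y) rfl
  have hB := mutInfo_block_le hN (p := p ∘ Fin.rev) (M := Wb ∘ Fin.rev) (fun k => hp k.rev)
    (fun k => hpsum k.rev) (fun k => hWb k.rev) (W := W2)
    (funext fun x => funext fun y => by
      obtain ⟨k, u⟩ := x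
      fin_cases k
      · exact hW2a u y
      · exact hW2b u y) rfl
  have hr1 : (fun y => W1 (0, ⟨0, hN⟩) y) = blockRow part (p 0) (Wb 0) ⟨0, hN⟩ :=
    funext (hW1a _)
  have hr2 : (fun y => W2 (0, ⟨0, hN⟩) y) = blockRow part (p 1) (Wb 1) ⟨0, hN⟩ :=
    funext (hW2a _)
  have hrev0 : (0 : Fin 2).rev = 1 := rfl
  have hrev1 : (1 : Fin 2).rev = 0 := rfl
  simp only [Function.comp_apply, hrev0, hrev1, add_comm (p 1 _) (p 0 _)] at hB
  obtain ⟨hA, hAu⟩ := hA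
  obtain ⟨hB, hBu⟩ := hB
  rw [hAu, hBu, hr1, hr2]
  simp only [add_mul, Finset.sum_add_distrib]
  refine ⟨fun P hP => ?_, ?_⟩
  · have hsum : ∑ u, P (0, u) = 1 - ∑ u, P (1, u) := by
      have h := hP.2
      rw [Fintype.sum_prod_type, Fin.sum_univ_two] at h
      linarith
    have h1 := hA P hP
    have h2 := hB P hP
    rw [hsum] at h1 h2
    refine le_min ?_ ?_ <;>
      linarith [min_le_left (mutInfo P W1) (mutInfo P W2),
        min_le_right (mutInfo P W1) (mutInfo P W2)]
  · rw [min_eq_left (by linarith)]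
    ring
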